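/- arXiv:2310.08271 — 2 statements merged into one kernel-verified Lean document; each statement's English description precedes it below -/
import Mathlib

section
/- Let ℓ≥2 and let V=[v_{i,j}] be an ℓ×ℓ matrix over R=𝔽₂[x]/⟨x^m+1⟩ with v_{0,j}=1 for all 0≤j<ℓ and such that: (1) the determinant of V is coprime with f_{p,τ}(x) in 𝔽₂[x]; (2) for every 0≤i<ℓ, the (m−τ)×ℓ(m−τ) binary matrix [𝒜_{τ,τ}(v_{i,0}) | … | 𝒜_{τ,τ}(v_{i,ℓ−1})] has full row rank m−τ over 𝔽₂; (3') x^τ+1 divides v_{i,j}+v_{i,k} for all 1≤i<ℓ and all 0≤j<k<ℓ. Then the ℓ(m−τ)×ℓ(m−τ) binary matrix 𝒯_{ℓ,ℓ,m}(V) has full rank over 𝔽₂ (i.e., it is invertible). -/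
open Polynomial

/-- The `(m-τ) × (m-τ)` binary matrix `𝒜_{τ,τ}(a)`: the top-left submatrix of the
`m × m` circulant matrix of `a` obtained by deleting the last `τ` rows and columns. -/
noncomputable def Att (m τ : ℕ) (a : Polynomial (ZMod 2)) :
    Matrix (Fin (m - τ)) (Fin (m - τ)) (ZMod 2) :=
  Matrix.of fun i j => a.coeff ((j.1 + (m - i.1)) % m)

/-- The block matrix `𝒯(B) = [𝒜_{τ,τ}(b_{i,j})]`. -/
noncomputable def Tmap {I J : Type*} (m τ : ℕ)
    (B : Matrix I J (Polynomial (ZMod 2))) :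
    Matrix (I × Fin (m - τ)) (J × Fin (m - τ)) (ZMod 2) :=
  Matrix.of fun r c => Att m τ (B r.1 c.1) r.2 c.2

/-- `f_{p,τ}(x) = 1 + x^τ + ⋯ + x^{(p-1)τ}` over `𝔽₂`. -/
noncomputable def fpoly (p τ : ℕ) : Polynomial (ZMod 2) :=
  ∑ i ∈ Finset.range p, Polynomial.X ^ (i * τ)

section CyclicShift

variable {R : Type*} [CommRing R]

theorem X_pow_sub_one_dvd_X_pow_sub_X_pow_mod (m n : ℕ) :
    (X ^ m - 1 : R[X]) ∣ X ^ n - X ^ (n % m) := by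
  have h : (X ^ n - X ^ (n % m) : R[X]) = X ^ (n % m) * ((X ^ m) ^ (n / m) - 1) := by
    rw [mul_sub, mul_one, ← pow_mul, ← pow_add, Nat.mod_add_div]
  rw [h]
  exact Dvd.dvd.mul_left (sub_one_dvd_pow_sub_one _ _) _

/-- Modulo `X ^ m - 1`, multiplying by `X ^ t` rotates the coefficients by `t`. -/
theorem X_pow_sub_one_dvd_X_pow_mul_sub_rotate (m t : ℕ) (ht : t < m) (a : R[X])
    (ha : a.degree < (m : WithBot ℕ)) :
    (X ^ m - 1 : R[X]) ∣
      X ^ t * a - ∑ c ∈ Finset.range m, C (a.coeff ((c + (m - t)) % m)) * X ^ c := by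
  have hrot : ∑ c ∈ Finset.range m, C (a.coeff ((c + (m - t)) % m)) * X ^ c =
      ∑ d ∈ Finset.range m, C (a.coeff d) * X ^ ((d + t) % m) := by
    have hm : 0 < m := by omega
    have back : ∀ c < m, ((c + (m - t)) % m + t) % m = c := by
      intro c hc
      rw [Nat.mod_add_mod, show c + (m - t) + t = c + m by omega, Nat.add_mod_right,
        Nat.mod_eq_of_lt hc]
    have forth : ∀ d < m, ((d + t) % m + (m - t)) % m = d := by
      intro d hd
      rw [Nat.mod_add_mod, show d + t + (m - t) = d + m by omega, Nat.add_mod_right,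
        Nat.mod_eq_of_lt hd]
    refine Finset.sum_nbij' (fun c => (c + (m - t)) % m) (fun d => (d + t) % m) ?_ ?_ ?_ ?_ ?_
    · intro c _
      exact Finset.mem_range.2 (Nat.mod_lt _ hm)
    · intro d _
      exact Finset.mem_range.2 (Nat.mod_lt _ hm)
    · intro c hc
      exact back c (Finset.mem_range.1 hc)
    · intro d hd
      exact forth d (Finset.mem_range.1 hd)
    · intro c hc
      simp only [back c (Finset.mem_range.1 hc)]
  have hsum : a = ∑ d ∈ Finset.range m, C (a.coeff d) * X ^ d := by
    ext n
    simp only [finsetSum_coeff, coeff_C_mul_X_pow, Finset.sum_ite_eq, Finset.mem_range]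
    split_ifs with h
    · rfl
    · exact coeff_eq_zero_of_degree_lt (ha.trans_le (by exact_mod_cast not_lt.1 h))
  rw [hrot]
  nth_rewrite 1 [hsum]
  rw [Finset.mul_sum, ← Finset.sum_sub_distrib]
  refine Finset.dvd_sum fun d _ => ?_
  have h : X ^ t * (C (a.coeff d) * X ^ d) - C (a.coeff d) * X ^ ((d + t) % m) =
      C (a.coeff d) * (X ^ (d + t) - X ^ ((d + t) % m)) := by ring
  rw [h]
  exact (X_pow_sub_one_dvd_X_pow_sub_X_pow_mod m (d + t)).mul_left _

theorem degree_sum_C_mul_X_pow_lt (n : ℕ) (g : ℕ → R) :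
    (∑ c ∈ Finset.range n, C (g c) * X ^ c).degree < (n : WithBot ℕ) :=
  mem_degreeLT.1 <| Submodule.sum_mem _ fun c hc => mem_degreeLT.2 <|
    (degree_C_mul_X_pow_le c (g c)).trans_lt (by exact_mod_cast Finset.mem_range.1 hc)

end CyclicShift

theorem dvd_of_dvd_vecMul_of_isCoprime_det {R n : Type*} [CommRing R] [Fintype n] [DecidableEq n]
    (M : Matrix n n R) (f : R) (hf : IsCoprime M.det f) (y : n → R)
    (hy : ∀ j, f ∣ Matrix.vecMul y M j) (i : n) : f ∣ y i := by
  have h : Matrix.vecMul (Matrix.vecMul y M) M.adjugate i = M.det * y i := by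
    rw [Matrix.vecMul_vecMul, Matrix.mul_adjugate, Matrix.vecMul_smul, Matrix.vecMul_one,
      Pi.smul_apply, smul_eq_mul]
  refine hf.symm.dvd_of_dvd_mul_left ?_
  rw [← h]
  exact Finset.dvd_sum fun j _ => (hy j).mul_right _

theorem fpoly_mul_X_pow_sub_one (p τ : ℕ) :
    fpoly p τ * (X ^ τ - 1) = X ^ (p * τ) - 1 := by
  have h := geom_sum_mul (X ^ τ : (ZMod 2)[X]) p
  simp only [← pow_mul] at h
  simpa only [fpoly, mul_comm] using h

theorem degree_fpoly (p τ : ℕ) (hp : 0 < p) (hτ : 0 < τ) :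
    (fpoly p τ).degree = ((p * τ - τ : ℕ) : WithBot ℕ) := by
  have h := congrArg degree (fpoly_mul_X_pow_sub_one p τ)
  have e : ∀ n : ℕ, 0 < n → (X ^ n - 1 : (ZMod 2)[X]).degree = (n : WithBot ℕ) := fun n hn => by
    simpa using degree_X_pow_sub_C (R := ZMod 2) hn 1
  have hne : fpoly p τ ≠ 0 := by
    rintro h0
    rw [h0, zero_mul, e _ (Nat.mul_pos hp hτ), degree_zero] at h
    exact WithBot.bot_ne_coe h
  rw [degree_mul, e _ hτ, e _ (Nat.mul_pos hp hτ), degree_eq_natDegree hne] at h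
  rw [degree_eq_natDegree hne]
  have h' : (fpoly p τ).natDegree + τ = p * τ := by exact_mod_cast h
  exact_mod_cast (by omega : (fpoly p τ).natDegree = p * τ - τ)

theorem stmt5 (p s τ m : ℕ) (hp : 1 < p) (hodd : Odd p)
    (hτ : τ = 2 ^ s) (hm : m = p * τ)
    (ℓ : ℕ) (hℓ : 2 ≤ ℓ)
    (V : Matrix (Fin ℓ) (Fin ℓ) (Polynomial (ZMod 2)))
    (hdeg : ∀ i j, (V i j).degree < (m : WithBot ℕ))
    (hrow0 : ∀ j : Fin ℓ, V ⟨0, by omega⟩ j = 1)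
    (h1 : IsCoprime V.det (fpoly p τ))
    (h2 : ∀ i : Fin ℓ,
      (Matrix.of fun (t : Fin (m - τ)) (q : Fin ℓ × Fin (m - τ)) =>
        Att m τ (V i q.1) t q.2).rank = m - τ)
    (h3 : ∀ i j k : Fin ℓ, 1 ≤ i.1 → j.1 < k.1 →
      (X ^ τ + 1 : Polynomial (ZMod 2)) ∣ (V i j + V i k)) :
    IsUnit (Tmap m τ V) := by
  have hτ0 : 0 < τ := hτ ▸ Nat.two_pow_pos s
  have hτm : τ ≤ m := hm ▸ Nat.le_mul_of_pos_left τ (by omega)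
  have hfac : fpoly p τ * (X ^ τ - 1) = X ^ m - 1 := by
    rw [hm]
    exact fpoly_mul_X_pow_sub_one p τ
  have hfdeg : (fpoly p τ).degree = ((m - τ : ℕ) : WithBot ℕ) := by
    rw [hm]
    exact degree_fpoly p τ (by omega) hτ0
  have hτdvd : (X ^ τ - 1 : (ZMod 2)[X]) ∣ X ^ m - 1 := Dvd.intro_left _ hfac
  have hfdvd : fpoly p τ ∣ X ^ m - 1 := Dvd.intro _ hfac
  have hXτ : (X ^ τ - 1 : (ZMod 2)[X]).degree = (τ : WithBot ℕ) := by
    simpa using degree_X_pow_sub_C (R := ZMod 2) hτ0 1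
  have hXm : (X ^ m - 1 : (ZMod 2)[X]).degree = (m : WithBot ℕ) := by
    simpa using degree_X_pow_sub_C (R := ZMod 2) (hτ0.trans_le hτm) 1
  have hcol : ∀ i j k : Fin ℓ, (X ^ τ - 1 : (ZMod 2)[X]) ∣ V i j - V i k := by
    intro i j k
    rw [CharTwo.sub_eq_add, CharTwo.sub_eq_add]
    by_cases hi : i = ⟨0, by omega⟩
    · rw [hi, hrow0, hrow0, CharTwo.add_self_eq_zero]
      exact dvd_zero _
    have hi1 : 1 ≤ i.1 := Nat.one_le_iff_ne_zero.2 fun h => hi (Fin.ext h)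
    rcases lt_trichotomy j.1 k.1 with h | h | h
    · exact h3 i j k hi1 h
    · rw [Fin.ext h, CharTwo.add_self_eq_zero]
      exact dvd_zero _
    · rw [add_comm (V i j)]
      exact h3 i k j hi1 h
  rw [← Matrix.vecMul_injective_iff_isUnit]
  refine (injective_iff_map_eq_zero (Matrix.vecMulLinear (Tmap m τ V))).2 ?_
  intro v hv
  let U : Fin ℓ → (ZMod 2)[X] := fun i => ∑ t : Fin (m - τ), C (v (i, t)) * X ^ t.1
  let g : Fin ℓ → ℕ → ZMod 2 := fun j c =>
    ∑ i, ∑ t : Fin (m - τ), v (i, t) * (V i j).coeff ((c + (m - t.1)) % m)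
  let w : Fin ℓ → (ZMod 2)[X] := fun j =>
    ∑ c ∈ Finset.range τ, C (g j (m - τ + c)) * X ^ c
  have hUcoeff : ∀ i (t : Fin (m - τ)), (U i).coeff t.1 = v (i, t) := by
    intro i t
    simp [U, finsetSum_coeff, Fin.val_inj]
  have hUdeg : ∀ i, (U i).degree < ((m - τ : ℕ) : WithBot ℕ) := fun i =>
    mem_degreeLT.1 <| Submodule.sum_mem _ fun c _ => mem_degreeLT.2 <|
      (degree_C_mul_X_pow_le _ _).trans_lt (by exact_mod_cast c.2)
  have hwdeg : ∀ j, (w j).degree < (τ : WithBot ℕ) := fun j => degree_sum_C_mul_X_pow_lt τ _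
  have hg : ∀ j, ∀ c < m - τ, g j c = 0 := by
    intro j c hc
    have h := congrFun hv (j, ⟨c, hc⟩)
    simpa [Matrix.vecMul, dotProduct, Fintype.sum_prod_type, Tmap, Att, g] using h
  have hsplit : ∀ j, ∑ c ∈ Finset.range m, C (g j c) * X ^ c = X ^ (m - τ) * w j := by
    intro j
    nth_rewrite 1 [← Nat.sub_add_cancel hτm]
    rw [Finset.sum_range_add, Finset.sum_eq_zero, zero_add, Finset.mul_sum]
    · refine Finset.sum_congr rfl fun c _ => ?_
      rw [pow_add]
      ring
    · intro c hc
      rw [hg j c (Finset.mem_range.1 hc), C_0, zero_mul]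
  have hprod : ∀ j, (X ^ m - 1 : (ZMod 2)[X]) ∣ ∑ i, U i * V i j - X ^ (m - τ) * w j := by
    intro j
    have h : ∑ i, U i * V i j - X ^ (m - τ) * w j =
        ∑ i, ∑ t : Fin (m - τ), C (v (i, t)) * (X ^ t.1 * V i j -
          ∑ c ∈ Finset.range m, C ((V i j).coeff ((c + (m - t.1)) % m)) * X ^ c) := by
      rw [← hsplit]
      simp only [U, g, mul_sub, Finset.sum_sub_distrib, Finset.sum_mul, Finset.mul_sum, map_sum,
        map_mul, mul_assoc]
      congr 1
      rw [Finset.sum_comm]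
      refine Finset.sum_congr rfl fun i _ => ?_
      rw [Finset.sum_comm]
    rw [h]
    exact Finset.dvd_sum fun i _ => Finset.dvd_sum fun t _ =>
      (X_pow_sub_one_dvd_X_pow_mul_sub_rotate m t.1 (by omega) _ (hdeg i j)).mul_left _
  have hXdvd : (X ^ τ - 1 : (ZMod 2)[X]) ∣ X ^ (m - τ) - 1 := by
    rw [hm, show p * τ - τ = τ * (p - 1) by rw [Nat.mul_sub, mul_one, mul_comm], pow_mul]
    exact sub_one_dvd_pow_sub_one _ _
  have hw : ∀ j k, w j = w k := by
    intro j k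
    have hd : (X ^ τ - 1 : (ZMod 2)[X]) ∣ w j - w k := by
      have hV : (X ^ τ - 1 : (ZMod 2)[X]) ∣ ∑ i, U i * (V i j - V i k) :=
        Finset.dvd_sum fun i _ => (hcol i j k).mul_left _
      have h : w j - w k = ∑ i, U i * (V i j - V i k)
          - (∑ i, U i * V i j - X ^ (m - τ) * w j) + (∑ i, U i * V i k - X ^ (m - τ) * w k)
          - (X ^ (m - τ) - 1) * (w j - w k) := by
        simp only [mul_sub, Finset.sum_sub_distrib]
        ring
      rw [h]
      exact (((hV.sub (hτdvd.trans (hprod j))).add (hτdvd.trans (hprod k))).sub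
        (hXdvd.mul_right _))
    refine sub_eq_zero.1 (eq_zero_of_dvd_of_degree_lt hd ?_)
    rw [hXτ]
    exact (degree_sub_le _ _).trans_lt (max_lt (hwdeg j) (hwdeg k))
  let o : Fin ℓ := ⟨0, by omega⟩
  have hrowo : ∀ j, V o j = 1 := hrow0
  have hy : ∀ i, fpoly p τ ∣ (U - Pi.single o (X ^ (m - τ) * w o) : Fin ℓ → (ZMod 2)[X]) i := by
    refine dvd_of_dvd_vecMul_of_isCoprime_det V _ h1 _ fun j => ?_
    rw [Matrix.sub_vecMul, Pi.sub_apply, Matrix.single_vecMul, Pi.smul_apply, hw o j]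
    simpa [hrowo, Matrix.vecMul, dotProduct] using hfdvd.trans (hprod j)
  have hU : ∀ i, i ≠ o → U i = 0 := by
    intro i hi
    have h := hy i
    rw [Pi.sub_apply, Pi.single_eq_of_ne hi, sub_zero] at h
    exact eq_zero_of_dvd_of_degree_lt h (hfdeg ▸ hUdeg i)
  have hUo : U o = X ^ (m - τ) * w o := by
    have h := hprod o
    rw [Finset.sum_eq_single o (fun i _ hi => by rw [hU i hi, zero_mul]) (by simp), hrowo,
      mul_one] at h
    refine sub_eq_zero.1 (eq_zero_of_dvd_of_degree_lt h ?_)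
    rw [hXm]
    refine (degree_sub_le _ _).trans_lt (max_lt ((hUdeg o).trans_le ?_) ?_)
    · exact_mod_cast Nat.sub_le m τ
    · rw [← hsplit]
      exact degree_sum_C_mul_X_pow_lt m _
  have hU0 : ∀ i, U i = 0 := by
    intro i
    by_cases hi : i = o
    · have h : X ^ (m - τ) ∣ U o := Dvd.intro _ hUo.symm
      rw [hi]
      exact eq_zero_of_dvd_of_degree_lt h (by rw [degree_X_pow]; exact hUdeg o)
    · exact hU i hi
  ext ⟨i, t⟩
  rw [← hUcoeff i t, hU0 i, coeff_zero, Pi.zero_apply]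
end

section
/- Let 2≤r<n and let H=[h_{i,j}] be an r×n matrix over R=𝔽₂[x]/⟨x^m+1⟩ such that: (1) the corresponding code over R_{p,τ} with parity-check matrix H reduced modulo f_{p,τ}(x) is MDS, i.e., for every choice of r column indices of H the determinant of the resulting r×r submatrix is coprime with f_{p,τ}(x) in 𝔽₂[x]; (2) gcd(h_{i,j}, x^m+1) = x^τ+1 for all 0≤i<r, 0≤j<n. Then the V-ETBR(n,r,m,H) code with binary parity-check matrix 𝒯_{r,n,m}(H) is a binary MDS array code: for every choice of r block-column indices, the r(m−τ)×r(m−τ) submatrix of 𝒯_{r,n,m}(H) consisting of those block columns is invertible over 𝔽₂. -/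
open Polynomial

/-- The reduction of `X ^ k * a` modulo `X ^ m + 1`, for `a` of degree less than `m`. -/
noncomputable def cyclicShift (m k : ℕ) (a : Polynomial (ZMod 2)) : Polynomial (ZMod 2) :=
  ∑ t ∈ Finset.range m, C (a.coeff ((t + (m - k)) % m)) * X ^ t

lemma coeff_cyclicShift {m k t : ℕ} (a : Polynomial (ZMod 2)) (ht : t < m) :
    (cyclicShift m k a).coeff t = a.coeff ((t + (m - k)) % m) := by
  simp [cyclicShift, coeff_C_mul, coeff_X_pow, ht]

lemma degree_cyclicShift_lt (m k : ℕ) (a : Polynomial (ZMod 2)) :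
    (cyclicShift m k a).degree < (m : WithBot ℕ) := by
  refine (degree_sum_le _ _).trans_lt ((Finset.sup_lt_iff (WithBot.bot_lt_coe m)).2 ?_)
  intro t ht
  exact (degree_C_mul_X_pow_le t _).trans_lt (WithBot.coe_lt_coe.2 (Finset.mem_range.1 ht))

lemma X_pow_add_one_eq_sub_one (m : ℕ) : (X ^ m + 1 : Polynomial (ZMod 2)) = X ^ m - 1 :=
  (CharTwo.sub_eq_add _ _).symm

lemma X_pow_add_one_dvd_X_pow_sub_X_pow_mod (m a : ℕ) :
    (X ^ m + 1 : Polynomial (ZMod 2)) ∣ X ^ a - X ^ (a % m) := by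
  have h : (X ^ a - X ^ (a % m) : Polynomial (ZMod 2)) =
      X ^ (a % m) * ((X ^ m) ^ (a / m) - 1) := by
    conv_lhs => rw [← Nat.mod_add_div a m, Nat.add_mul_mod_self_left, Nat.mod_mod]
    ring
  rw [h, X_pow_add_one_eq_sub_one]
  exact (sub_one_dvd_pow_sub_one _ _).mul_left _

lemma X_pow_add_one_dvd_X_pow_mul_sub_cyclicShift {m k : ℕ} (hk : k < m)
    (a : Polynomial (ZMod 2)) (ha : a.degree < (m : WithBot ℕ)) :
    (X ^ m + 1 : Polynomial (ZMod 2)) ∣ X ^ k * a - cyclicShift m k a := by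
  have hsum : cyclicShift m k a =
      ∑ t ∈ Finset.range m, C (a.coeff t) * X ^ ((t + k) % m) := by
    refine Finset.sum_nbij' (fun t => (t + (m - k)) % m) (fun t => (t + k) % m) ?_ ?_ ?_ ?_ ?_
    · intro t _
      exact Finset.mem_range.2 (Nat.mod_lt _ (by omega))
    · intro t _
      exact Finset.mem_range.2 (Nat.mod_lt _ (by omega))
    · intro t ht
      rw [Finset.mem_range] at ht
      simp only [Nat.mod_add_mod]
      rw [show t + (m - k) + k = t + m by omega, Nat.add_mod_right, Nat.mod_eq_of_lt ht]
    · intro t ht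
      rw [Finset.mem_range] at ht
      simp only [Nat.mod_add_mod]
      rw [show t + k + (m - k) = t + m by omega, Nat.add_mod_right, Nat.mod_eq_of_lt ht]
    · intro t ht
      rw [Finset.mem_range] at ht
      simp only [Nat.mod_add_mod]
      rw [show t + (m - k) + k = t + m by omega, Nat.add_mod_right, Nat.mod_eq_of_lt ht]
  have ha' : a = ∑ t ∈ Finset.range m, C (a.coeff t) * X ^ t := by
    ext t
    by_cases ht : t < m
    · simp [coeff_C_mul, coeff_X_pow, ht]
    · have h0 : a.coeff t = 0 :=
        coeff_eq_zero_of_degree_lt (ha.trans_le (by exact_mod_cast not_lt.1 ht))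
      simp [coeff_C_mul, coeff_X_pow, ht, h0]
  rw [hsum]
  nth_rewrite 1 [ha']
  rw [Finset.mul_sum, ← Finset.sum_sub_distrib]
  refine Finset.dvd_sum fun t _ => ?_
  rw [show X ^ k * (C (a.coeff t) * X ^ t) - C (a.coeff t) * X ^ ((t + k) % m) =
    C (a.coeff t) * (X ^ (t + k) - X ^ ((t + k) % m)) by ring]
  exact (X_pow_add_one_dvd_X_pow_sub_X_pow_mod m (t + k)).mul_left _

lemma degree_X_pow_add_one {m : ℕ} (hm : 0 < m) :
    (X ^ m + 1 : Polynomial (ZMod 2)).degree = m := by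
  simpa using degree_X_pow_add_C hm (1 : ZMod 2)

lemma fpoly_mul (p τ : ℕ) : fpoly p τ * (X ^ τ + 1) = X ^ (p * τ) + 1 := by
  have h := geom_sum_mul (X ^ τ : Polynomial (ZMod 2)) p
  simp only [← pow_mul] at h
  rw [X_pow_add_one_eq_sub_one, X_pow_add_one_eq_sub_one, mul_comm p τ, ← h, fpoly]
  simp only [mul_comm]

/-- A multiple of `X ^ τ + 1` of degree less than `m` whose coefficients below `m - τ`
vanish is zero, provided that `X ^ τ + 1` divides `X ^ m + 1`. -/
lemma eq_zero_of_X_pow_add_one_dvd {m τ : ℕ} (hτ : 0 < τ) (hτm : τ ≤ m)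
    (hdvd : (X ^ τ + 1 : Polynomial (ZMod 2)) ∣ X ^ m + 1) {q : Polynomial (ZMod 2)}
    (hq : (X ^ τ + 1 : Polynomial (ZMod 2)) ∣ q) (hdeg : q.degree < (m : WithBot ℕ))
    (hcoeff : ∀ t < m - τ, q.coeff t = 0) : q = 0 := by
  obtain ⟨w, rfl⟩ := X_pow_dvd_iff.2 hcoeff
  have hw : (X ^ τ + 1 : Polynomial (ZMod 2)) ∣ w := by
    have h := dvd_sub (hdvd.mul_right w) (hq.mul_left (X ^ τ))
    rwa [← mul_assoc, ← pow_add, Nat.add_sub_cancel' hτm, ← sub_mul, add_sub_cancel_left,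
      one_mul] at h
  by_contra hne
  have hw0 : w ≠ 0 := right_ne_zero_of_mul hne
  have h1 := degree_le_of_dvd hw hw0
  rw [degree_X_pow_add_one hτ, degree_eq_natDegree hw0] at h1
  rw [degree_mul, degree_X_pow, degree_eq_natDegree hw0] at hdeg
  norm_cast at h1 hdeg
  omega

lemma dvd_of_dvd_vecMul {R I : Type*} [CommRing R] [Fintype I] [DecidableEq I]
    {A : Matrix I I R} {f : R} (hA : IsCoprime A.det f) {u : I → R}
    (h : ∀ j, f ∣ Matrix.vecMul u A j) (i : I) : f ∣ u i := by
  have hu : Matrix.vecMul (Matrix.vecMul u A) A.adjugate = A.det • u := by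
    rw [Matrix.vecMul_vecMul, Matrix.mul_adjugate, Matrix.vecMul_smul, Matrix.vecMul_one]
  have hdvd : f ∣ A.det * u i := by
    rw [← smul_eq_mul, ← Pi.smul_apply, ← hu]
    exact Finset.dvd_sum fun j _ => (h j).mul_right _
  exact hA.symm.dvd_of_dvd_mul_left hdvd

theorem isUnit_Tmap {I : Type*} [Fintype I] [DecidableEq I] {p τ m : ℕ} (hp : 0 < p)
    (hτ : 0 < τ) (hm : m = p * τ) (A : Matrix I I (Polynomial (ZMod 2)))
    (hdeg : ∀ i j, (A i j).degree < (m : WithBot ℕ)) (hdet : IsCoprime A.det (fpoly p τ))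
    (hdvd : ∀ i j, (X ^ τ + 1 : Polynomial (ZMod 2)) ∣ A i j) : IsUnit (Tmap m τ A) := by
  have hτm : τ ≤ m := hm ▸ Nat.le_mul_of_pos_left τ hp
  have hfm : fpoly p τ * (X ^ τ + 1) = X ^ m + 1 := hm ▸ fpoly_mul p τ
  rw [← Matrix.vecMul_injective_iff_isUnit]
  refine (injective_iff_map_eq_zero (Matrix.vecMulLinear (Tmap m τ A))).2 fun u hu => ?_
  replace hu : Matrix.vecMul u (Tmap m τ A) = 0 := hu
  let U : I → Polynomial (ZMod 2) := fun i => ∑ k : Fin (m - τ), C (u (i, k)) * X ^ k.1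
  have hUcoeff (i : I) (k : Fin (m - τ)) : (U i).coeff k.1 = u (i, k) := by
    simp [U, coeff_C_mul, coeff_X_pow, Fin.val_inj]
  have hUdeg (i : I) : (U i).degree < ((m - τ : ℕ) : WithBot ℕ) := by
    refine (degree_sum_le _ _).trans_lt ((Finset.sup_lt_iff (WithBot.bot_lt_coe _)).2 ?_)
    intro k _
    exact (degree_C_mul_X_pow_le k.1 _).trans_lt (by exact_mod_cast k.2)
  have hvec (j : I) : (X ^ m + 1 : Polynomial (ZMod 2)) ∣ Matrix.vecMul U A j := by
    let Q := ∑ i, ∑ k : Fin (m - τ), C (u (i, k)) * cyclicShift m k.1 (A i j)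
    have hUQ : (X ^ m + 1 : Polynomial (ZMod 2)) ∣ Matrix.vecMul U A j - Q := by
      simp only [Matrix.vecMul, dotProduct, U, Q, Finset.sum_mul, ← Finset.sum_sub_distrib]
      refine Finset.dvd_sum fun i _ => Finset.dvd_sum fun k _ => ?_
      rw [mul_assoc, ← mul_sub]
      exact (X_pow_add_one_dvd_X_pow_mul_sub_cyclicShift (by omega) _ (hdeg i j)).mul_left _
    have hτQ : (X ^ τ + 1 : Polynomial (ZMod 2)) ∣ Q := by
      have h1 : (X ^ τ + 1 : Polynomial (ZMod 2)) ∣ Matrix.vecMul U A j :=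
        Finset.dvd_sum fun i _ => (hdvd i j).mul_left _
      exact (dvd_sub_right h1).1 ((Dvd.intro_left _ hfm).trans hUQ)
    have hQdeg : Q.degree < (m : WithBot ℕ) := by
      refine mem_degreeLT.1 (Submodule.sum_mem _ fun i _ => Submodule.sum_mem _ fun k _ => ?_)
      rw [C_mul']
      exact Submodule.smul_mem _ _ (mem_degreeLT.2 (degree_cyclicShift_lt _ _ _))
    have hQcoeff : ∀ t < m - τ, Q.coeff t = 0 := by
      intro t ht
      have h := congrFun hu (j, ⟨t, ht⟩)
      simp only [Matrix.vecMul, dotProduct, Fintype.sum_prod_type, Tmap, Att, Matrix.of_apply,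
        Pi.zero_apply] at h
      simpa only [Q, finsetSum_coeff, coeff_C_mul,
        coeff_cyclicShift _ (ht.trans_le (Nat.sub_le m τ))] using h
    have hQ : Q = 0 :=
      eq_zero_of_X_pow_add_one_dvd hτ hτm (Dvd.intro_left _ hfm) hτQ hQdeg hQcoeff
    simpa [hQ] using hUQ
  have hU (i : I) : U i = 0 := by
    by_contra hne
    have hf := dvd_of_dvd_vecMul hdet (fun j => (Dvd.intro _ hfm).trans (hvec j)) i
    have hX : (X ^ τ + 1 : Polynomial (ZMod 2)) ≠ 0 :=
      ne_zero_of_degree_gt (n := ⊥) (by rw [degree_X_pow_add_one hτ]; exact WithBot.bot_lt_coe τ)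
    have h := degree_le_of_dvd (mul_dvd_mul_right hf (X ^ τ + 1)) (mul_ne_zero hne hX)
    have hUi := hUdeg i
    rw [hfm, degree_mul, degree_X_pow_add_one (hτ.trans_le hτm), degree_X_pow_add_one hτ,
      degree_eq_natDegree hne] at h
    rw [degree_eq_natDegree hne] at hUi
    norm_cast at h hUi
    omega
  ext ⟨i, k⟩
  simp [← hUcoeff, hU]

theorem stmt7 (p s τ m : ℕ) (hp : 1 < p) (hodd : Odd p)
    (hτ : τ = 2 ^ s) (hm : m = p * τ)
    (r n : ℕ) (hr : 2 ≤ r) (hrn : r < n)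
    (H : Matrix (Fin r) (Fin n) (Polynomial (ZMod 2)))
    (hdeg : ∀ i j, (H i j).degree < (m : WithBot ℕ))
    (hMDS : ∀ φ : Fin r → Fin n, Function.Injective φ →
      IsCoprime (H.submatrix id φ).det (fpoly p τ))
    (hgcd : ∀ (i : Fin r) (j : Fin n),
      EuclideanDomain.gcd (H i j) (X ^ m + 1 : Polynomial (ZMod 2)) = X ^ τ + 1) :
    ∀ φ : Fin r → Fin n, Function.Injective φ →
      IsUnit (Tmap m τ (H.submatrix id φ)) := by
  intro φ hφ
  refine isUnit_Tmap (by omega) (hτ ▸ by positivity) hm _ (fun i j => hdeg _ _) (hMDS φ hφ) ?_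
  intro i j
  exact hgcd i (φ j) ▸ EuclideanDomain.gcd_dvd_left _ _
end
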